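/- Let I be a finite nonempty index set, let (p_i)_{i∈I} be a probability distribution, and let σ_i be density matrices on ℂ^m and η_i be density matrices on ℂ^n for each i ∈ I. Then S(∑_i p_i σ_i ⊗ η_i) ≥ S(∑_i p_i σ_i) + ∑_i p_i S(η_i). -/

import Mathlib

open scoped Kronecker BigOperators ComplexOrder

/-- Von Neumann entropy (base 2) of a matrix, via eigenvalues when Hermitian. -/
noncomputable def vNEntropy {n : Type*} [Fintype n] [DecidableEq n] (ρ : Matrix n n ℂ) : ℝ :=
  if h : ρ.IsHermitian then -∑ k, h.eigenvalues k * Real.logb 2 (h.eigenvalues k) else 0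

/-- A density matrix: positive semidefinite with trace one. -/
def IsDensityMatrix {n : Type*} [Fintype n] [DecidableEq n] (ρ : Matrix n n ℂ) : Prop :=
  ρ.PosSemidef ∧ ρ.trace = 1

/-- Shannon entropy (base 2). -/
noncomputable def shannonH {I : Type*} [Fintype I] (p : I → ℝ) : ℝ :=
  -∑ i, p i * Real.logb 2 (p i)

/-- Holevo information of an ensemble. -/
noncomputable def holevo {I n : Type*} [Fintype I] [Fintype n] [DecidableEq n]
    (p : I → ℝ) (ρ : I → Matrix n n ℂ) : ℝ :=
  vNEntropy (∑ i, (p i : ℂ) • ρ i) - ∑ i, p i * vNEntropy (ρ i)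

open Matrix Filter Topology

/-- If `M D Mᴴ` is diagonal, the `D`-weighted squared norm of a row of `X M` is a weighted squared
norm of the same row of `X`. -/
lemma sum_weight_norm_sq_mul {α K L : Type*} [Fintype α] [DecidableEq α] [Fintype K]
    [DecidableEq K] (d : α → ℝ) (r : K → ℝ) (M : Matrix K α ℂ) (X : Matrix L K ℂ)
    (h : M * diagonal (fun a => (d a : ℂ)) * Mᴴ = diagonal (fun k => (r k : ℂ))) (l : L) :
    ∑ a, d a * ‖(X * M) l a‖ ^ 2 = ∑ k, r k * ‖X l k‖ ^ 2 := by
  have h1 : (X * M) * diagonal (fun a => (d a : ℂ)) * (X * M)ᴴ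
      = X * diagonal (fun k => (r k : ℂ)) * Xᴴ := by
    rw [← h, conjTranspose_mul]; simp only [Matrix.mul_assoc]
  have h2 := congrFun (congrFun h1 l) l
  rw [mul_apply, mul_apply] at h2
  simp only [mul_diagonal, conjTranspose_apply] at h2
  have key : ∀ (z : ℂ) (x : ℝ), z * x * star z = ((x * ‖z‖ ^ 2 : ℝ) : ℂ) := by
    intro z x
    have := Complex.mul_conj' z
    push_cast
    rw [← this, Complex.star_def]; ring
  simp only [key] at h2
  exact_mod_cast h2

lemma norm_sq_sum_mul_le {J : Type*} [Fintype J] (x y : J → ℂ) (hx : ∑ j, ‖x j‖ ^ 2 = 1) :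
    ‖∑ j, x j * y j‖ ^ 2 ≤ ∑ j, ‖y j‖ ^ 2 := by
  have h1 : ‖∑ j, x j * y j‖ ≤ ∑ j, ‖x j‖ * ‖y j‖ :=
    (norm_sum_le _ _).trans_eq (by simp)
  calc ‖∑ j, x j * y j‖ ^ 2 ≤ (∑ j, ‖x j‖ * ‖y j‖) ^ 2 := by gcongr
    _ ≤ (∑ j, ‖x j‖ ^ 2) * ∑ j, ‖y j‖ ^ 2 := Finset.sum_mul_sq_le_sq_mul_sq _ _ _
    _ = _ := by rw [hx, one_mul]

lemma two_mul_sub_sq_le_div {x w y z : ℝ} (hw : 0 ≤ w) (h0 : w = 0 → x = 0) (hyz : y ^ 2 ≤ z) :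
    2 * (x * y) - w * z ≤ x ^ 2 / w := by
  rcases hw.eq_or_lt with h | h
  · simp [h0 h.symm, ← h]
  · rw [le_div_iff₀ h]
    nlinarith [sq_nonneg (x - w * y), mul_le_mul_of_nonneg_left hyz (sq_nonneg w)]

/-- Monotonicity of the resolvent quadratic form `⟨ρ, (L_σ + s R_ρ)⁻¹ ρ⟩` for mixtures of rank-one
projections, expressed in eigenbases of the mixtures. -/
lemma sum_norm_sq_mul_sq_div_le {α J K : Type*} [Fintype α] [DecidableEq α] [Fintype J]
    [DecidableEq J] [Fintype K] [DecidableEq K] {ρ σ : α → ℝ} {t : J → ℝ} {r : K → ℝ}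
    {A : Matrix J α ℂ} {B : Matrix K α ℂ} {C : Matrix J K ℂ}
    (hρ : ∀ a, 0 ≤ ρ a) (hσ : ∀ a, 0 ≤ σ a)
    (hρσ : ∀ a, σ a = 0 → ρ a = 0)
    (hA : A * diagonal (fun a => (σ a : ℂ)) * Aᴴ = diagonal (fun j => (t j : ℂ)))
    (hB : B * diagonal (fun a => (ρ a : ℂ)) * Bᴴ = diagonal (fun k => (r k : ℂ)))
    (hAB : A * diagonal (fun a => (ρ a : ℂ)) * Bᴴ = C * diagonal (fun k => (r k : ℂ)))
    (hA1 : ∀ a, ∑ j, ‖A j a‖ ^ 2 = 1) (hB1 : ∀ a, ∑ k, ‖B k a‖ ^ 2 = 1)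
    {s : ℝ} (hs : 0 ≤ s) :
    ∑ j, ∑ k, ‖C j k‖ ^ 2 * (r k ^ 2 / (t j + s * r k)) ≤ ∑ a, ρ a ^ 2 / (σ a + s * ρ a) := by
  set L := ∑ j, ∑ k, ‖C j k‖ ^ 2 * (r k ^ 2 / (t j + s * r k)) with hL
  let X : Matrix J K ℂ := fun j k => C j k * ((r k / (t j + s * r k) : ℝ) : ℂ)
  have hX : ∀ j k, X j k = C j k * ((r k / (t j + s * r k) : ℝ) : ℂ) := fun _ _ => rfl
  let z : α → ℂ := fun a => (Aᴴ * X * B) a a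
  have hz1 : ∀ a, ‖z a‖ ^ 2 ≤ ∑ j, ‖(X * B) j a‖ ^ 2 := by
    intro a
    have : z a = ∑ j, Aᴴ a j * (X * B) j a := by
      simp only [z, Matrix.mul_assoc]; rw [mul_apply]
    rw [this]
    exact norm_sq_sum_mul_le _ _ (by simpa using hA1 a)
  have hz2 : ∀ a, ‖z a‖ ^ 2 ≤ ∑ k, ‖(Xᴴ * A) k a‖ ^ 2 := by
    intro a
    have : z a = ∑ k, B k a * (Aᴴ * X) a k := by
      simp only [z]; rw [mul_apply]; exact Finset.sum_congr rfl fun _ _ => mul_comm _ _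
    rw [this]
    refine (norm_sq_sum_mul_le _ _ (hB1 a)).trans_eq (Finset.sum_congr rfl fun k _ => ?_)
    have : Aᴴ * X = (Xᴴ * A)ᴴ := by simp
    rw [this, conjTranspose_apply, norm_star]
  have e1 : ∑ a, ρ a * (z a).re = L := by
    have h1 : (Aᴴ * X * B * diagonal (fun a => (ρ a : ℂ))).trace
        = (X * (C * diagonal (fun k => (r k : ℂ)))ᴴ).trace := by
      rw [← hAB, conjTranspose_mul, conjTranspose_mul, conjTranspose_conjTranspose,
        diagonal_conjTranspose]
      have : (star fun a => (ρ a : ℂ)) = fun a => (ρ a : ℂ) := by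
        ext a; simp
      rw [this, Matrix.mul_assoc, Matrix.mul_assoc, trace_mul_comm]
      simp only [Matrix.mul_assoc]
    have h2 := congrArg Complex.re h1
    simp only [trace, diag_apply, mul_diagonal, Complex.re_sum] at h2
    rw [hL]
    convert h2 using 2 with a _ j
    · simp [z, mul_comm]
    · rw [mul_apply, Complex.re_sum]
      refine Finset.sum_congr rfl fun k _ => ?_
      rw [hX, conjTranspose_apply, mul_diagonal]
      have : C j k * ((r k / (t j + s * r k) : ℝ) : ℂ) * star (C j k * (r k : ℂ))
          = ((‖C j k‖ ^ 2 * (r k ^ 2 / (t j + s * r k)) : ℝ) : ℂ) := by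
        have := Complex.mul_conj' (C j k)
        push_cast
        rw [← this]; simp; ring
      rw [this, Complex.ofReal_re]
  have e2 : ∑ a, ρ a * ∑ j, ‖(X * B) j a‖ ^ 2 = ∑ j, ∑ k, r k * ‖X j k‖ ^ 2 := by
    simp only [Finset.mul_sum]
    rw [Finset.sum_comm]
    exact Finset.sum_congr rfl fun j _ => sum_weight_norm_sq_mul _ _ _ _ hB j
  have e3 : ∑ a, σ a * ∑ k, ‖(Xᴴ * A) k a‖ ^ 2 = ∑ j, ∑ k, t j * ‖X j k‖ ^ 2 := by
    simp only [Finset.mul_sum]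
    rw [Finset.sum_comm, Finset.sum_comm (s := (Finset.univ : Finset J))]
    refine Finset.sum_congr rfl fun k _ => ?_
    rw [sum_weight_norm_sq_mul _ _ _ _ hA k]
    simp
  have e4 : ∑ j, ∑ k, t j * ‖X j k‖ ^ 2 + s * ∑ j, ∑ k, r k * ‖X j k‖ ^ 2 = L := by
    rw [hL, Finset.mul_sum, ← Finset.sum_add_distrib]
    refine Finset.sum_congr rfl fun j _ => ?_
    rw [Finset.mul_sum, ← Finset.sum_add_distrib]
    refine Finset.sum_congr rfl fun k _ => ?_
    rw [hX, norm_mul, Complex.norm_real, mul_pow, Real.norm_eq_abs, sq_abs]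
    by_cases h : t j + s * r k = 0
    · simp [h]
    · field_simp
  have e5 : ∀ a, 2 * (ρ a * (z a).re) - (σ a * ∑ k, ‖(Xᴴ * A) k a‖ ^ 2
      + s * (ρ a * ∑ j, ‖(X * B) j a‖ ^ 2)) ≤ ρ a ^ 2 / (σ a + s * ρ a) := by
    intro a
    have hsρ := mul_nonneg hs (hρ a)
    refine le_trans ?_ (two_mul_sub_sq_le_div (y := (z a).re) (z := ‖z a‖ ^ 2)
      (add_nonneg (hσ a) hsρ) ?_ ?_)
    · nlinarith [mul_le_mul_of_nonneg_left (hz2 a) (hσ a), mul_le_mul_of_nonneg_left (hz1 a) hsρ]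
    · intro h
      exact hρσ a (by linarith [hσ a])
    · rw [← sq_abs]
      gcongr
      exact Complex.abs_re_le_norm _
  have e6 := Finset.sum_le_sum fun a (_ : a ∈ Finset.univ) => e5 a
  rw [Finset.sum_sub_distrib, Finset.sum_add_distrib, ← Finset.mul_sum, ← Finset.mul_sum, e1, e2,
    e3, e4] at e6
  linarith

lemma hasDerivAt_mul_log_add_mul {c x y s : ℝ} (h : c ≠ 0 → 0 < x ∧ 0 < y) (hs : 0 ≤ s) :
    HasDerivAt (fun s => c * Real.log (x + s * y)) (c * (y / (x + s * y))) s := by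
  by_cases hc : c = 0
  · simpa [hc] using hasDerivAt_const s (0 : ℝ)
  · obtain ⟨hx, hy⟩ := h hc
    have : HasDerivAt (fun s => x + s * y) y s := by
      simpa using ((hasDerivAt_id s).mul_const y).const_add x
    exact (this.log (by positivity)).const_mul c

lemma tendsto_mul_log_add_mul_sub_log {c x y : ℝ} (h : c ≠ 0 → 0 < x ∧ 0 < y) :
    Tendsto (fun s => c * (Real.log (x + s * y) - Real.log s)) atTop (𝓝 (c * Real.log y)) := by
  by_cases hc : c = 0
  · simp [hc]
  · obtain ⟨hx, hy⟩ := h hc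
    have h1 : Tendsto (fun s : ℝ => x / s + y) atTop (𝓝 (0 + y)) :=
      (tendsto_const_nhds.div_atTop tendsto_id).add_const y
    rw [zero_add] at h1
    refine ((h1.log hy.ne').const_mul c).congr' ?_
    filter_upwards [eventually_gt_atTop 0] with s hs
    rw [← Real.log_div (by positivity) hs.ne']
    congr 2
    field_simp

/-- If `Φ(s) = ∑ c log (x + s y) - ∑ c' log (x' + s y')` with equal total weights has nonnegative
derivative, then `Φ(0) ≤ lim Φ(s)`. -/
lemma sum_mul_log_sub_le {α β : Type*} [Fintype α] [Fintype β] {c x y : α → ℝ} {c' x' y' : β → ℝ}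
    (h : ∀ a, c a ≠ 0 → 0 < x a ∧ 0 < y a) (h' : ∀ b, c' b ≠ 0 → 0 < x' b ∧ 0 < y' b)
    (hc : ∑ a, c a = ∑ b, c' b)
    (hd : ∀ s, 0 ≤ s →
      ∑ b, c' b * (y' b / (x' b + s * y' b)) ≤ ∑ a, c a * (y a / (x a + s * y a))) :
    ∑ a, c a * Real.log (x a) - ∑ b, c' b * Real.log (x' b)
      ≤ ∑ a, c a * Real.log (y a) - ∑ b, c' b * Real.log (y' b) := by
  let Φ : ℝ → ℝ := fun s =>
    ∑ a, c a * Real.log (x a + s * y a) - ∑ b, c' b * Real.log (x' b + s * y' b)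
  have hΦ : ∀ s, 0 ≤ s → HasDerivAt Φ (∑ a, c a * (y a / (x a + s * y a))
      - ∑ b, c' b * (y' b / (x' b + s * y' b))) s := fun s hs =>
    (HasDerivAt.fun_sum fun a _ => hasDerivAt_mul_log_add_mul (h a) hs).fun_sub
      (HasDerivAt.fun_sum fun b _ => hasDerivAt_mul_log_add_mul (h' b) hs)
  have hmono : MonotoneOn Φ (Set.Ici 0) := by
    refine monotoneOn_of_deriv_nonneg (convex_Ici 0)
      (fun s hs => (hΦ s hs).continuousAt.continuousWithinAt)
      (fun s hs => (hΦ s (interior_subset hs)).differentiableAt.differentiableWithinAt) ?_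
    intro s hs
    have hs0 : 0 ≤ s := interior_subset hs
    rw [(hΦ s hs0).deriv]
    exact sub_nonneg.2 (hd s hs0)
  have hlim : Tendsto Φ atTop (𝓝 (∑ a, c a * Real.log (y a) - ∑ b, c' b * Real.log (y' b))) := by
    refine ((tendsto_finsetSum _ fun a _ => tendsto_mul_log_add_mul_sub_log (h a)).sub
      (tendsto_finsetSum _ fun b _ => tendsto_mul_log_add_mul_sub_log (h' b))).congr fun s => ?_
    simp only [Φ, mul_sub, Finset.sum_sub_distrib, ← Finset.sum_mul, hc]
    ring
  have hle : Φ 0 ≤ ∑ a, c a * Real.log (y a) - ∑ b, c' b * Real.log (y' b) := by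
    refine ge_of_tendsto hlim ?_
    filter_upwards [eventually_ge_atTop 0] with s hs
    exact hmono (Set.mem_Ici.2 le_rfl) (Set.mem_Ici.2 hs) hs
  simpa [Φ] using hle

/-- Joint convexity of the relative entropy for mixtures of rank-one projections, expressed in
eigenbases of the mixtures. -/
lemma sum_mul_log_sub_le_of_mixture {α J K : Type*} [Fintype α] [DecidableEq α] [Fintype J]
    [DecidableEq J] [Fintype K] [DecidableEq K] {ρ σ : α → ℝ} {t : J → ℝ} {r : K → ℝ}
    {A : Matrix J α ℂ} {B : Matrix K α ℂ} {C : Matrix J K ℂ}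
    (hρ : ∀ a, 0 ≤ ρ a) (hσ : ∀ a, 0 ≤ σ a) (ht : ∀ j, 0 ≤ t j) (hr : ∀ k, 0 ≤ r k)
    (hρσ : ∀ a, σ a = 0 → ρ a = 0)
    (hA : A * diagonal (fun a => (σ a : ℂ)) * Aᴴ = diagonal (fun j => (t j : ℂ)))
    (hB : B * diagonal (fun a => (ρ a : ℂ)) * Bᴴ = diagonal (fun k => (r k : ℂ)))
    (hAB : A * diagonal (fun a => (ρ a : ℂ)) * Bᴴ = C * diagonal (fun k => (r k : ℂ)))
    (hA1 : ∀ a, ∑ j, ‖A j a‖ ^ 2 = 1) (hB1 : ∀ a, ∑ k, ‖B k a‖ ^ 2 = 1)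
    (hC1 : ∀ k, ∑ j, ‖C j k‖ ^ 2 = 1) :
    ∑ a, ρ a * Real.log (σ a) - ∑ j, (∑ k, r k * ‖C j k‖ ^ 2) * Real.log (t j)
      ≤ ∑ a, ρ a * Real.log (ρ a) - ∑ k, r k * Real.log (r k) := by
  have hker : ∀ j k, r k * ‖C j k‖ ^ 2 ≠ 0 → 0 < t j ∧ 0 < r k := by
    intro j k hjk
    have hrk : r k ≠ 0 := left_ne_zero_of_mul hjk
    refine ⟨(ht j).lt_of_ne' fun htj => ?_, (hr k).lt_of_ne' hrk⟩
    have h1 := sum_weight_norm_sq_mul σ t A (1 : Matrix J J ℂ) hA j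
    rw [Finset.sum_eq_single (s := Finset.univ) (f := fun k => t k * ‖(1 : Matrix J J ℂ) j k‖ ^ 2) j
      (fun b _ hb => by simp [one_apply_ne hb.symm]) (by simp), htj, zero_mul, Matrix.one_mul,
      Finset.sum_eq_zero_iff_of_nonneg fun a _ => mul_nonneg (hσ a) (sq_nonneg _)] at h1
    have h2 : ∀ a, A j a * (ρ a : ℂ) = 0 := by
      intro a
      rcases mul_eq_zero.1 (h1 a (Finset.mem_univ a)) with h | h
      · simp [hρσ a h]
      · simp [norm_eq_zero.1 (pow_eq_zero_iff two_ne_zero |>.1 h)]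
    have h3 := congrFun (congrFun hAB j) k
    rw [mul_apply, mul_diagonal] at h3
    simp only [mul_diagonal, h2, zero_mul, Finset.sum_const_zero] at h3
    rcases mul_eq_zero.1 h3.symm with h | h
    · simp [h] at hjk
    · exact hrk (by exact_mod_cast h)
  have htr : ∑ a, ρ a = ∑ k, r k := by
    have h1 : ∑ k, ∑ a, ρ a * ‖((1 : Matrix K K ℂ) * B) k a‖ ^ 2 = ∑ k, r k :=
      Finset.sum_congr rfl fun k _ => by
        rw [sum_weight_norm_sq_mul _ _ _ _ hB, Finset.sum_eq_single k
          (fun b _ hb => by simp [one_apply_ne hb.symm]) (by simp)]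
        simp
    rw [← h1, Finset.sum_comm]
    simp [← Finset.mul_sum, hB1]
  have hsum : ∀ g : K → ℝ, ∑ b : J × K, r b.2 * ‖C b.1 b.2‖ ^ 2 * g b.2 = ∑ k, r k * g k := by
    intro g
    rw [Fintype.sum_prod_type_right]
    refine Finset.sum_congr rfl fun k _ => ?_
    change ∑ j, r k * ‖C j k‖ ^ 2 * g k = r k * g k
    rw [← Finset.sum_mul, ← Finset.mul_sum, hC1, mul_one]
  have := sum_mul_log_sub_le (c := ρ) (x := σ) (y := ρ)
    (c' := fun b : J × K => r b.2 * ‖C b.1 b.2‖ ^ 2) (x' := fun b => t b.1) (y' := fun b => r b.2)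
    (fun a ha => ⟨(hσ a).lt_of_ne' fun h => ha (hρσ a h), (hρ a).lt_of_ne' ha⟩)
    (fun b hb => hker b.1 b.2 hb) (by simpa [htr] using (hsum fun _ => 1).symm) ?_
  · rw [hsum fun k => Real.log (r k)] at this
    rw [Fintype.sum_prod_type] at this
    simpa only [← Finset.sum_mul] using this
  · intro s hs
    refine le_of_eq_of_le ?_ ((sum_norm_sq_mul_sq_div_le hρ hσ hρσ hA hB hAB hA1 hB1
      hs).trans_eq ?_)
    · rw [Fintype.sum_prod_type]
      exact Finset.sum_congr rfl fun j _ => Finset.sum_congr rfl fun k _ => by ring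
    · exact Finset.sum_congr rfl fun a _ => by ring

lemma sum_norm_sq_col_of_mem_unitaryGroup {N : Type*} [Fintype N] [DecidableEq N]
    {M : Matrix N N ℂ} (hM : M ∈ unitaryGroup N ℂ) (a : N) : ∑ j, ‖M j a‖ ^ 2 = 1 := by
  have h := congrFun (congrFun (mem_unitaryGroup_iff'.1 hM) a) a
  rw [mul_apply, one_apply_eq] at h
  simp only [star_apply, Complex.star_def, Complex.conj_mul'] at h
  exact_mod_cast h

/-- Joint convexity of the relative entropy for mixtures of commuting pairs: the pairs
`W i diag(w i) (W i)ᴴ`, `W i diag(v i) (W i)ᴴ` mix to `R` and `S`, with eigenbases `V` and `U`. -/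
lemma sum_mul_log_sub_le_of_unitary {I N : Type*} [Fintype I] [DecidableEq I] [Fintype N]
    [DecidableEq N] {w v : I → N → ℝ} {W : I → Matrix N N ℂ} {U V R S : Matrix N N ℂ}
    {t r : N → ℝ}
    (hw : ∀ i y, 0 ≤ w i y) (hv : ∀ i y, 0 ≤ v i y) (ht : ∀ j, 0 ≤ t j) (hr : ∀ k, 0 ≤ r k)
    (hwv : ∀ i y, v i y = 0 → w i y = 0) (hW : ∀ i, W i ∈ unitaryGroup N ℂ)
    (hU : U ∈ unitaryGroup N ℂ) (hV : V ∈ unitaryGroup N ℂ)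
    (hR : ∑ i, W i * diagonal (fun y => (w i y : ℂ)) * (W i)ᴴ = R)
    (hS : ∑ i, W i * diagonal (fun y => (v i y : ℂ)) * (W i)ᴴ = S)
    (hUS : S = U * diagonal (fun j => (t j : ℂ)) * Uᴴ)
    (hVR : R = V * diagonal (fun k => (r k : ℂ)) * Vᴴ) :
    ∑ i, ∑ y, w i y * Real.log (v i y) - ∑ j, ((Uᴴ * R * U) j j).re * Real.log (t j)
      ≤ ∑ i, ∑ y, w i y * Real.log (w i y) - ∑ k, r k * Real.log (r k) := by
  let F : Matrix N (I × N) ℂ := fun x a => W a.1 x a.2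
  have hF : ∀ d : I → N → ℝ, F * diagonal (fun a : I × N => (d a.1 a.2 : ℂ)) * Fᴴ
      = ∑ i, W i * diagonal (fun y => (d i y : ℂ)) * (W i)ᴴ := by
    intro d
    ext x x'
    rw [mul_apply, Fintype.sum_prod_type, Matrix.sum_apply]
    refine Finset.sum_congr rfl fun i _ => ?_
    rw [mul_apply]
    refine Finset.sum_congr rfl fun y _ => ?_
    rw [mul_diagonal, mul_diagonal]
    rfl
  have hUU : Uᴴ * U = 1 := mem_unitaryGroup_iff'.1 hU
  have hVV : Vᴴ * V = 1 := mem_unitaryGroup_iff'.1 hV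
  have hcol : ∀ {Z : Matrix N N ℂ}, Z ∈ unitaryGroup N ℂ →
      ∀ a, ∑ j, ‖(Zᴴ * F) j a‖ ^ 2 = 1 := fun {Z} hZ a =>
    sum_norm_sq_col_of_mem_unitaryGroup (mul_mem (Unitary.star_mem hZ) (hW a.1)) a.2
  have hC : Uᴴ * V ∈ unitaryGroup N ℂ := mul_mem (Unitary.star_mem hU) hV
  have hA : (Uᴴ * F) * diagonal (fun a : I × N => (v a.1 a.2 : ℂ)) * (Uᴴ * F)ᴴ
      = diagonal (fun j => (t j : ℂ)) := by
    calc _ = Uᴴ * (F * diagonal (fun a : I × N => (v a.1 a.2 : ℂ)) * Fᴴ) * U := by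
          simp [Matrix.mul_assoc]
      _ = (Uᴴ * U) * diagonal (fun j => (t j : ℂ)) * (Uᴴ * U) := by
          rw [hF, hS, hUS]; simp only [Matrix.mul_assoc]
      _ = _ := by simp [hUU]
  have hB : (Vᴴ * F) * diagonal (fun a : I × N => (w a.1 a.2 : ℂ)) * (Vᴴ * F)ᴴ
      = diagonal (fun k => (r k : ℂ)) := by
    calc _ = Vᴴ * (F * diagonal (fun a : I × N => (w a.1 a.2 : ℂ)) * Fᴴ) * V := by
          simp [Matrix.mul_assoc]
      _ = (Vᴴ * V) * diagonal (fun k => (r k : ℂ)) * (Vᴴ * V) := by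
          rw [hF, hR, hVR]; simp only [Matrix.mul_assoc]
      _ = _ := by simp [hVV]
  have hAB : (Uᴴ * F) * diagonal (fun a : I × N => (w a.1 a.2 : ℂ)) * (Vᴴ * F)ᴴ
      = (Uᴴ * V) * diagonal (fun k => (r k : ℂ)) := by
    calc _ = Uᴴ * (F * diagonal (fun a : I × N => (w a.1 a.2 : ℂ)) * Fᴴ) * V := by
          simp [Matrix.mul_assoc]
      _ = (Uᴴ * V) * diagonal (fun k => (r k : ℂ)) * (Vᴴ * V) := by
          rw [hF, hR, hVR]; simp only [Matrix.mul_assoc]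
      _ = _ := by simp [hVV]
  have hdiag : ∀ j, ∑ k, r k * ‖(Uᴴ * V) j k‖ ^ 2 = ((Uᴴ * R * U) j j).re := by
    intro j
    have h1 : Uᴴ * R * U = (Uᴴ * V) * diagonal (fun k => (r k : ℂ)) * (Uᴴ * V)ᴴ := by
      rw [hVR]; simp [Matrix.mul_assoc]
    rw [h1, mul_apply, Complex.re_sum]
    refine Finset.sum_congr rfl fun k _ => ?_
    rw [mul_diagonal, conjTranspose_apply, mul_right_comm, Complex.star_def, Complex.mul_conj',
      mul_comm]
    norm_cast
  have := sum_mul_log_sub_le_of_mixture (ρ := fun a : I × N => w a.1 a.2)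
    (σ := fun a : I × N => v a.1 a.2) (fun a => hw _ _) (fun a => hv _ _) ht hr
    (fun a => hwv _ _) hA hB hAB (hcol hU) (hcol hV) (sum_norm_sq_col_of_mem_unitaryGroup hC)
  simpa only [hdiag, Fintype.sum_prod_type] using this

lemma Matrix.IsHermitian.eq_eigenvectorUnitary_mul {N : Type*} [Fintype N] [DecidableEq N]
    {ρ : Matrix N N ℂ} (h : ρ.IsHermitian) :
    ρ = (h.eigenvectorUnitary : Matrix N N ℂ) * diagonal (fun k => (h.eigenvalues k : ℂ))
      * (h.eigenvectorUnitary : Matrix N N ℂ)ᴴ :=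
  h.spectral_theorem

lemma vNEntropy_eq {N : Type*} [Fintype N] [DecidableEq N] {ρ : Matrix N N ℂ}
    (h : ρ.IsHermitian) :
    vNEntropy ρ = -(∑ k, h.eigenvalues k * Real.log (h.eigenvalues k)) / Real.log 2 := by
  rw [vNEntropy, dif_pos h, neg_div, Finset.sum_div]
  simp only [Real.logb, mul_div_assoc]

lemma IsDensityMatrix.sum_eigenvalues {N : Type*} [Fintype N] [DecidableEq N] {ρ : Matrix N N ℂ}
    (h : IsDensityMatrix ρ) : ∑ k, h.1.isHermitian.eigenvalues k = 1 := by
  have := h.2.symm.trans h.1.isHermitian.trace_eq_sum_eigenvalues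
  refine Complex.ofReal_injective ?_
  rw [Complex.ofReal_sum, Complex.ofReal_one]
  exact this.symm

/-- Lemma 4.1 of the paper:
`S(∑ i, p i • σ i ⊗ η i) ≥ S(∑ i, p i • σ i) + ∑ i, p i * S(η i)`. -/
theorem stmt0 {I : Type} [Fintype I] [Nonempty I] (m n : ℕ)
    (p : I → ℝ) (hp : ∀ i, 0 ≤ p i) (hp1 : ∑ i, p i = 1)
    (σ : I → Matrix (Fin m) (Fin m) ℂ) (hσ : ∀ i, IsDensityMatrix (σ i))
    (η : I → Matrix (Fin n) (Fin n) ℂ) (hη : ∀ i, IsDensityMatrix (η i)) :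
    vNEntropy (∑ i, (p i : ℂ) • (σ i ⊗ₖ η i)) ≥
      vNEntropy (∑ i, (p i : ℂ) • σ i) + ∑ i, p i * vNEntropy (η i) := by
  classical
  have hpC : ∀ i, (0 : ℂ) ≤ p i := fun i => by exact_mod_cast hp i
  have hR : (∑ i, (p i : ℂ) • (σ i ⊗ₖ η i)).PosSemidef :=
    posSemidef_sum _ fun i _ => ((hσ i).1.kronecker (hη i).1).smul (hpC i)
  have hT : (∑ i, (p i : ℂ) • σ i).PosSemidef :=
    posSemidef_sum _ fun i _ => (hσ i).1.smul (hpC i)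
  set R := ∑ i, (p i : ℂ) • (σ i ⊗ₖ η i) with hRdef
  set T := ∑ i, (p i : ℂ) • σ i with hTdef
  let s : I → Fin m → ℝ := fun i => (hσ i).1.isHermitian.eigenvalues
  let h : I → Fin n → ℝ := fun i => (hη i).1.isHermitian.eigenvalues
  let Us : I → Matrix (Fin m) (Fin m) ℂ := fun i => (hσ i).1.isHermitian.eigenvectorUnitary
  let Uh : I → Matrix (Fin n) (Fin n) ℂ := fun i => (hη i).1.isHermitian.eigenvectorUnitary
  have hUs : ∀ i, Us i ∈ unitaryGroup _ ℂ := fun i => Subtype.prop _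
  have hUh : ∀ i, Uh i ∈ unitaryGroup _ ℂ := fun i => Subtype.prop _
  have hs : ∀ i, σ i = Us i * diagonal (fun j => (s i j : ℂ)) * (Us i)ᴴ := fun i =>
    (hσ i).1.isHermitian.eq_eigenvectorUnitary_mul
  have hh : ∀ i, η i = Uh i * diagonal (fun j => (h i j : ℂ)) * (Uh i)ᴴ := fun i =>
    (hη i).1.isHermitian.eq_eigenvectorUnitary_mul
  have hs0 : ∀ i j, 0 ≤ s i j := fun i => (hσ i).1.eigenvalues_nonneg
  have hh0 : ∀ i j, 0 ≤ h i j := fun i => (hη i).1.eigenvalues_nonneg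
  have hs1 : ∀ i, ∑ j, s i j = 1 := fun i => (hσ i).sum_eigenvalues
  let U : Matrix (Fin m) (Fin m) ℂ := hT.isHermitian.eigenvectorUnitary
  have hU : U ∈ unitaryGroup _ ℂ := Subtype.prop _
  have hUT : T = U * diagonal (fun j => (hT.isHermitian.eigenvalues j : ℂ)) * Uᴴ :=
    hT.isHermitian.eq_eigenvectorUnitary_mul
  have key := sum_mul_log_sub_le_of_unitary (W := fun i => Us i ⊗ₖ Uh i)
    (w := fun i y => p i * (s i y.1 * h i y.2)) (v := fun i y => p i * s i y.1)
    (U := U ⊗ₖ (1 : Matrix (Fin n) (Fin n) ℂ)) (V := hR.isHermitian.eigenvectorUnitary)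
    (t := fun y => hT.isHermitian.eigenvalues y.1) (r := hR.isHermitian.eigenvalues)
    (R := R) (S := T ⊗ₖ (1 : Matrix (Fin n) (Fin n) ℂ))
    (fun i y => mul_nonneg (hp i) (mul_nonneg (hs0 _ _) (hh0 _ _)))
    (fun i y => mul_nonneg (hp i) (hs0 _ _)) (fun y => hT.eigenvalues_nonneg _)
    hR.eigenvalues_nonneg
    (fun i y hy => by rw [← mul_assoc, hy, zero_mul])
    (fun i => kronecker_mem_unitary (hUs i) (hUh i)) (kronecker_mem_unitary hU (one_mem _))
    (Subtype.prop _) ?_ ?_ ?_ hR.isHermitian.eq_eigenvectorUnitary_mul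
  · have hterm : ∑ i, ∑ y : Fin m × Fin n, p i * (s i y.1 * h i y.2) * Real.log (p i * s i y.1)
        - ∑ i, ∑ y : Fin m × Fin n,
          p i * (s i y.1 * h i y.2) * Real.log (p i * (s i y.1 * h i y.2))
        = -∑ i, p i * ∑ k, h i k * Real.log (h i k) := by
      rw [← Finset.sum_sub_distrib, ← Finset.sum_neg_distrib]
      refine Finset.sum_congr rfl fun i _ => ?_
      have : ∀ j k, p i * (s i j * h i k) * Real.log (p i * s i j)
          - p i * (s i j * h i k) * Real.log (p i * (s i j * h i k))
          = -(s i j * (p i * (h i k * Real.log (h i k)))) := by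
        intro j k
        by_cases h1 : p i * s i j = 0
        · rw [← mul_assoc, h1]
          rcases mul_eq_zero.1 h1 with h2 | h2 <;> simp [h2]
        by_cases h2 : h i k = 0
        · simp [h2]
        rw [← mul_assoc, Real.log_mul h1 h2]
        ring
      rw [← Finset.sum_sub_distrib, Fintype.sum_prod_type]
      simp only [this, Finset.sum_neg_distrib, ← Finset.mul_sum]
      rw [← Finset.sum_mul, hs1, one_mul]
    have hmarg : ∀ j, ∑ b, (((U ⊗ₖ (1 : Matrix (Fin n) (Fin n) ℂ))ᴴ * R
        * (U ⊗ₖ (1 : Matrix (Fin n) (Fin n) ℂ))) (j, b) (j, b)).re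
        = hT.isHermitian.eigenvalues j := by
      intro j
      have h1 : (U ⊗ₖ (1 : Matrix (Fin n) (Fin n) ℂ))ᴴ * R * (U ⊗ₖ (1 : Matrix (Fin n) (Fin n) ℂ))
          = ∑ i, (p i : ℂ) • ((Uᴴ * σ i * U) ⊗ₖ η i) := by
        rw [hRdef, Finset.mul_sum, Finset.sum_mul]
        refine Finset.sum_congr rfl fun i _ => ?_
        rw [conjTranspose_kronecker, Matrix.mul_smul, Matrix.smul_mul, ← mul_kronecker_mul,
          ← mul_kronecker_mul]
        simp
      have h2 : Uᴴ * T * U = diagonal (fun j => (hT.isHermitian.eigenvalues j : ℂ)) := by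
        have hUU : Uᴴ * U = 1 := mem_unitaryGroup_iff'.1 hU
        calc Uᴴ * T * U = (Uᴴ * U) * diagonal (fun j => (hT.isHermitian.eigenvalues j : ℂ))
              * (Uᴴ * U) := by
              conv_lhs => rw [hUT]
              simp only [Matrix.mul_assoc]
          _ = _ := by simp [hUU]
      have h3 : ∑ b, ((U ⊗ₖ (1 : Matrix (Fin n) (Fin n) ℂ))ᴴ * R
          * (U ⊗ₖ (1 : Matrix (Fin n) (Fin n) ℂ))) (j, b) (j, b) = (Uᴴ * T * U) j j := by
        rw [h1, hTdef, Finset.mul_sum, Finset.sum_mul]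
        simp only [Matrix.sum_apply, Matrix.smul_apply, kronecker_apply, Matrix.mul_smul,
          Matrix.smul_mul, smul_eq_mul]
        rw [Finset.sum_comm]
        refine Finset.sum_congr rfl fun i _ => ?_
        have : ∑ b, η i b b = 1 := (hη i).2
        rw [← Finset.mul_sum, ← Finset.mul_sum, this, mul_one]
      rw [← Complex.re_sum, h3, h2, diagonal_apply_eq, Complex.ofReal_re]
    rw [Fintype.sum_prod_type (f := fun y : Fin m × Fin n =>
      (((U ⊗ₖ (1 : Matrix (Fin n) (Fin n) ℂ))ᴴ * R * (U ⊗ₖ (1 : Matrix (Fin n) (Fin n) ℂ))) y y).re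
        * Real.log (hT.isHermitian.eigenvalues y.1))] at key
    simp only [← Finset.sum_mul, hmarg] at key
    have hη' : ∑ i, p i * vNEntropy (η i)
        = (-∑ i, p i * ∑ k, h i k * Real.log (h i k)) / Real.log 2 := by
      rw [neg_div, Finset.sum_div, ← Finset.sum_neg_distrib]
      refine Finset.sum_congr rfl fun i _ => ?_
      rw [vNEntropy_eq (hη i).1.isHermitian]
      ring
    rw [ge_iff_le, vNEntropy_eq hR.isHermitian, vNEntropy_eq hT.isHermitian, hη', ← add_div]
    have := Real.log_pos one_lt_two
    gcongr
    linarith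
  · rw [hRdef]
    refine Finset.sum_congr rfl fun i _ => ?_
    rw [conjTranspose_kronecker]
    have : diagonal (fun y : Fin m × Fin n => ((p i * (s i y.1 * h i y.2) : ℝ) : ℂ))
        = (p i : ℂ) • (diagonal (fun j => (s i j : ℂ)) ⊗ₖ diagonal (fun k => (h i k : ℂ))) := by
      rw [diagonal_kronecker_diagonal, ← diagonal_smul]
      congr 1
      ext y
      simp
    rw [this, Matrix.mul_smul, Matrix.smul_mul, ← mul_kronecker_mul, ← mul_kronecker_mul, ← hs,
      ← hh]
  · rw [hTdef]
    have hsum : (∑ i, (p i : ℂ) • σ i) ⊗ₖ (1 : Matrix (Fin n) (Fin n) ℂ)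
        = ∑ i, (p i : ℂ) • (σ i ⊗ₖ (1 : Matrix (Fin n) (Fin n) ℂ)) := by
      ext x y
      simp [Matrix.sum_apply, Finset.sum_mul, mul_assoc]
    rw [hsum]
    refine Finset.sum_congr rfl fun i _ => ?_
    rw [conjTranspose_kronecker]
    have : diagonal (fun y : Fin m × Fin n => ((p i * s i y.1 : ℝ) : ℂ))
        = (p i : ℂ) • (diagonal (fun j => (s i j : ℂ)) ⊗ₖ (1 : Matrix (Fin n) (Fin n) ℂ)) := by
      rw [← diagonal_one, diagonal_kronecker_diagonal, ← diagonal_smul]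
      congr 1
      ext y
      simp
    have hUU : Uh i * (Uh i)ᴴ = 1 := mem_unitaryGroup_iff.1 (hUh i)
    rw [this, Matrix.mul_smul, Matrix.smul_mul, ← mul_kronecker_mul, ← mul_kronecker_mul, ← hs,
      Matrix.mul_one, hUU]
  · have : diagonal (fun y : Fin m × Fin n => (hT.isHermitian.eigenvalues y.1 : ℂ))
        = diagonal (fun j => (hT.isHermitian.eigenvalues j : ℂ))
          ⊗ₖ (1 : Matrix (Fin n) (Fin n) ℂ) := by
      rw [← diagonal_one, diagonal_kronecker_diagonal]
      simp
    rw [this, conjTranspose_kronecker, ← mul_kronecker_mul, ← mul_kronecker_mul, ← hUT]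
    simp
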